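/- Let m ≥ 2 be an integer, n odd with 1 ≤ n ≤ 4m−1, and set θ = 4m−n+1. For each choice of sign ±, there exist constants b₀, b₁ ∈ ℝ∖{0} depending only on n and m, constants a_j^± ∈ ℂ∖ℝ for 0 ≤ j ≤ ⌊(4m−n)/2⌋, and a smooth function r_θ^± : (0,∞) → ℂ such that: (a) for all λ > 0 and all x ≠ y in ℝⁿ, R₀^±(λ^{2m})(x,y) = b₀ |x−y|^{2m−n} + Σ_{0 ≤ j ≤ ⌊(4m−n)/2⌋} a_j^± λ^{n−2m+2j} |x−y|^{2j} + b₁ λ^{2m} |x−y|^{4m−n} + λ^{n−2m} r_θ^±(λ|x−y|); (b) for every l ∈ ℕ₀ there is C_l > 0 with |d^l r_θ^±/dz^l (z)| ≤ C_l z^{max{θ−l, 0}} for 0 < z ≤ 1 and |d^l r_θ^±/dz^l (z)| ≤ C_l z^{max{θ−l, −(n−1)/2}} for z ≥ 1. -/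

import Mathlib

open MeasureTheory Finset

/-- The coefficients `c_j` in the explicit formula for the free resolvent kernel. -/
noncomputable def cCoef (n : ℕ) (j : ℤ) : ℝ :=
  if j = -1 then -(1/2 : ℝ)
  else ((-2 : ℝ)) ^ j.toNat * (Nat.factorial (n - 3 - j.toNat)) /
      ((Nat.factorial j.toNat) * (Nat.factorial ((((n : ℤ) - 3) / 2 - j).toNat)))

/-- `λ_k = λ e^{ikπ/m}`. -/
noncomputable def lamK (m : ℕ) (lam : ℝ) (k : ℕ) : ℂ :=
  (lam : ℂ) * Complex.exp (Complex.I * (k : ℂ) * (Real.pi : ℂ) / (m : ℂ))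

/-- The limiting free resolvent kernel `R₀^±(λ^{2m})(x,y)` of `(-Δ)^m` on `ℝⁿ`, odd `n`,
as a function of `λ` and `r = |x - y|`.  The sign `+` corresponds to `sgn = true`
(with `I⁺ = {0, …, m-1}`), the sign `-` to `sgn = false` (with `I⁻ = {1, …, m}`). -/
noncomputable def R0Kernel (m n : ℕ) (sgn : Bool) (lam r : ℝ) : ℂ :=
  ((((4 * Real.pi) ^ (-(((n : ℝ) - 1) / 2)) : ℝ)) : ℂ) *
    ((m : ℂ) * (lam : ℂ) ^ (2 * m))⁻¹ *
    ∑ k ∈ (if sgn then Finset.range m else Finset.Icc 1 m),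
      (lamK m lam k) ^ 2 * Complex.exp (Complex.I * lamK m lam k * (r : ℂ)) *
        (r : ℂ) ^ (-((n : ℤ) - 2)) *
        ∑ j ∈ Finset.Icc (min 0 (((n : ℤ) - 3) / 2)) (((n : ℤ) - 3) / 2),
          ((cCoef n j : ℝ) : ℂ) * (Complex.I * lamK m lam k * (r : ℂ)) ^ j

/-- `f` is entire and its Taylor coefficients at `0` are those of the formal power series `p`. -/
def HasEntireTaylorSeries (p : PowerSeries ℝ) (f : ℂ → ℂ) : Prop :=
  ∀ K : ℕ, ∃ H : ℂ → ℂ, Differentiable ℂ H ∧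
    ∀ w, f w = ∑ s ∈ Finset.range K, ((PowerSeries.coeff s p : ℝ) : ℂ) * w ^ s + w ^ K * H w

namespace HasEntireTaylorSeries

theorem exp : HasEntireTaylorSeries (PowerSeries.exp ℝ) Complex.exp := by
  intro K
  obtain ⟨H, hH, hHe⟩ := AnalyticAt.exists_eq_sum_add_pow_mul
    (f := Complex.exp) (Complex.differentiable_exp.analyticAt 0) K
  have hco : ∀ w : ℂ, Complex.exp w =
      ∑ s ∈ Finset.range K, ((PowerSeries.coeff s (PowerSeries.exp ℝ) : ℝ) : ℂ) * w ^ s +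
        w ^ K * H w := by
    intro w
    rw [hHe w]
    congr 1
    refine Finset.sum_congr rfl fun s _ => ?_
    rw [iteratedDeriv_eq_iterate, Complex.iter_deriv_exp, PowerSeries.coeff_exp]
    simp [div_eq_inv_mul]
  refine ⟨H, fun w => ?_, hco⟩
  rcases eq_or_ne w 0 with rfl | hw
  · exact hH.differentiableAt
  · have hev : H =ᶠ[nhds w] fun v => (Complex.exp v -
        ∑ s ∈ Finset.range K, ((PowerSeries.coeff s (PowerSeries.exp ℝ) : ℝ) : ℂ) * v ^ s) /
          v ^ K := by
      filter_upwards [isOpen_ne.mem_nhds hw] with v hv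
      rw [eq_div_iff (pow_ne_zero _ hv), hco v]
      ring
    refine DifferentiableAt.congr_of_eventuallyEq ?_ hev
    refine DifferentiableAt.div ?_ (by fun_prop) (pow_ne_zero _ hw)
    fun_prop

theorem add {p q : PowerSeries ℝ} {f g : ℂ → ℂ} (hf : HasEntireTaylorSeries p f)
    (hg : HasEntireTaylorSeries q g) : HasEntireTaylorSeries (p + q) (fun w => f w + g w) := by
  intro K
  obtain ⟨F, hF, hFe⟩ := hf K
  obtain ⟨G, hG, hGe⟩ := hg K
  refine ⟨fun w => F w + G w, hF.add hG, fun w => ?_⟩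
  beta_reduce
  rw [hFe w, hGe w]
  simp only [map_add, Complex.ofReal_add, add_mul, Finset.sum_add_distrib]
  ring

theorem const_mul {p : PowerSeries ℝ} {f : ℂ → ℂ} (c : ℝ) (hf : HasEntireTaylorSeries p f) :
    HasEntireTaylorSeries (PowerSeries.C c * p) (fun w => c * f w) := by
  intro K
  obtain ⟨F, hF, hFe⟩ := hf K
  refine ⟨fun w => c * F w, hF.const_mul _, fun w => ?_⟩
  beta_reduce
  rw [hFe w, mul_add, Finset.mul_sum]
  simp only [PowerSeries.coeff_C_mul, Complex.ofReal_mul, mul_assoc]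
  ring

theorem X_mul {p : PowerSeries ℝ} {f : ℂ → ℂ} (hf : HasEntireTaylorSeries p f) :
    HasEntireTaylorSeries (PowerSeries.X * p) (fun w => w * f w) := by
  rintro (_ | K)
  · obtain ⟨F, hF, hFe⟩ := hf 0
    refine ⟨fun w => w * F w, differentiable_id.mul hF, fun w => ?_⟩
    beta_reduce
    rw [hFe w]
    simp
  · obtain ⟨F, hF, hFe⟩ := hf K
    refine ⟨F, hF, fun w => ?_⟩
    beta_reduce
    rw [hFe w, Finset.sum_range_succ', mul_add, Finset.mul_sum]
    simp only [PowerSeries.coeff_succ_X_mul, PowerSeries.coeff_zero_X_mul, Complex.ofReal_zero,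
      zero_mul, add_zero, pow_succ]
    congr 1
    · exact Finset.sum_congr rfl fun s _ => by ring
    · ring

theorem X_pow_mul {p : PowerSeries ℝ} {f : ℂ → ℂ} (hf : HasEntireTaylorSeries p f) (i : ℕ) :
    HasEntireTaylorSeries (PowerSeries.X ^ i * p) (fun w => w ^ i * f w) := by
  induction i with
  | zero => simpa using hf
  | succ i ih => simpa only [pow_succ', mul_assoc] using ih.X_mul

theorem exp_mul_polynomial (Q : Polynomial ℝ) :
    HasEntireTaylorSeries (PowerSeries.exp ℝ * (Q : PowerSeries ℝ))
      (fun w => Complex.exp w * Polynomial.aeval w Q) := by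
  induction Q using Polynomial.induction_on' with
  | add P Q hP hQ =>
    simpa only [Polynomial.coe_add, map_add, mul_add] using hP.add hQ
  | monomial i c =>
    have h := (exp.X_pow_mul i).const_mul c
    have e1 : PowerSeries.C c * (PowerSeries.X ^ i * PowerSeries.exp ℝ) =
        PowerSeries.exp ℝ * ((Polynomial.monomial i c : Polynomial ℝ) : PowerSeries ℝ) := by
      rw [← Polynomial.C_mul_X_pow_eq_monomial, Polynomial.coe_mul, Polynomial.coe_C,
        Polynomial.coe_pow, Polynomial.coe_X]
      ring
    have e2 : (fun w : ℂ => (c : ℂ) * (w ^ i * Complex.exp w)) =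
        fun w => Complex.exp w * Polynomial.aeval w (Polynomial.monomial i c) := by
      funext w
      rw [Polynomial.aeval_monomial]
      simp only [Complex.coe_algebraMap]
      ring
    rwa [e1, e2] at h

end HasEntireTaylorSeries

/-- The coefficients of the reverse Bessel-type polynomial of degree `N`. -/
noncomputable def besselCoeff (N j : ℕ) : ℝ :=
  if j ≤ N then (-2) ^ j * (2 * N - j).factorial / (j.factorial * (N - j).factorial) else 0

theorem besselCoeff_succ (N j : ℕ) :
    (j + 1) * (2 * N - j) * besselCoeff N (j + 1) = -2 * (N - j) * besselCoeff N j := by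
  unfold besselCoeff
  rcases lt_trichotomy j N with h | rfl | h
  · obtain ⟨d, rfl⟩ : ∃ d, N = j + 1 + d := ⟨N - j - 1, by omega⟩
    rw [if_pos (by omega), if_pos (by omega),
      show 2 * (j + 1 + d) - (j + 1) = j + 1 + 2 * d by omega,
      show 2 * (j + 1 + d) - j = (j + 1 + 2 * d) + 1 by omega,
      show j + 1 + d - (j + 1) = d by omega, show j + 1 + d - j = d + 1 by omega]
    have h1 := Nat.factorial_ne_zero j
    have h2 := Nat.factorial_ne_zero d
    rw [Nat.factorial_succ (j + 1 + 2 * d), Nat.factorial_succ j, Nat.factorial_succ d]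
    push_cast
    field_simp
    ring
  · simp
  · rw [if_neg (by omega), if_neg (by omega)]
    simp

/-- The polynomial with coefficients `besselCoeff N`. -/
noncomputable def besselPoly (N : ℕ) : Polynomial ℝ :=
  ∑ j ∈ Finset.range (N + 1), Polynomial.monomial j (besselCoeff N j)

theorem coeff_besselPoly (N j : ℕ) : (besselPoly N).coeff j = besselCoeff N j := by
  simp only [besselPoly, Polynomial.finsetSum_coeff, Polynomial.coeff_monomial,
    Finset.sum_ite_eq', Finset.mem_range]
  split_ifs with h
  · rfl
  · rw [besselCoeff, if_neg (by omega)]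

open PowerSeries in
/-- The two-step recurrence coming from the Bessel equation
`X F'' - 2 N F' - X F = 0` for `F = exp * besselPoly N`. -/
theorem coeff_exp_mul_besselPoly_recurrence (N s : ℕ) :
    (s + 2 : ℝ) * (s + 1 - 2 * N) *
      coeff (s + 2) (PowerSeries.exp ℝ * (besselPoly N : PowerSeries ℝ)) =
        coeff s (PowerSeries.exp ℝ * (besselPoly N : PowerSeries ℝ)) ∧
    N * coeff 1 (PowerSeries.exp ℝ * (besselPoly N : PowerSeries ℝ)) = 0 := by
  set P : PowerSeries ℝ := (besselPoly N : PowerSeries ℝ) with hP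
  have hPc : ∀ j, coeff j P = besselCoeff N j := fun j => by
    rw [hP, Polynomial.coeff_coe, coeff_besselPoly]
  have hPode : X * d⁄dX ℝ (d⁄dX ℝ P) + C 2 * (X * d⁄dX ℝ P) - C (2 * N : ℝ) * d⁄dX ℝ P
      - C (2 * N : ℝ) * P = 0 := by
    ext j
    rcases j with _ | j
    · have := besselCoeff_succ N 0
      simp only [map_add, map_sub, coeff_C_mul, coeff_zero_X_mul, coeff_derivative, hPc, map_zero]
      push_cast at this ⊢
      linarith
    · have := besselCoeff_succ N (j + 1)
      simp only [map_add, map_sub, coeff_C_mul, coeff_succ_X_mul, coeff_derivative, hPc, map_zero]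
      push_cast at this ⊢
      linarith
  have hode : X * d⁄dX ℝ (d⁄dX ℝ (PowerSeries.exp ℝ * P))
      - C (2 * N : ℝ) * d⁄dX ℝ (PowerSeries.exp ℝ * P) - X * (PowerSeries.exp ℝ * P) = 0 := by
    have h2 : (C 2 : PowerSeries ℝ) = 2 := map_ofNat C 2
    rw [h2] at hPode
    simp only [Derivation.leibniz, map_add, smul_eq_mul, derivative_exp]
    linear_combination (PowerSeries.exp ℝ) * hPode
  set F := PowerSeries.exp ℝ * P
  constructor
  · have := congrArg (coeff (s + 1)) hode
    simp only [map_sub, coeff_C_mul, coeff_succ_X_mul, coeff_derivative, map_zero] at this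
    push_cast at this
    linarith
  · have := congrArg (coeff 0) hode
    simp only [map_sub, coeff_C_mul, coeff_zero_X_mul, coeff_derivative, map_zero] at this
    push_cast at this
    linarith

theorem coeff_exp_mul_besselPoly_ne_zero (N : ℕ) :
    PowerSeries.coeff (2 * N + 1)
      (PowerSeries.exp ℝ * (besselPoly N : PowerSeries ℝ)) ≠ 0 := by
  have hval : PowerSeries.coeff (2 * N + 1)
      (PowerSeries.exp ℝ * (besselPoly N : PowerSeries ℝ)) =
      (N.factorial : ℝ)⁻¹ * ∫ t in (0 : ℝ)..1, t ^ N * (t - 2) ^ N := by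
    have hexp : ∀ t : ℝ, t ^ N * (t - 2) ^ N =
        ∑ j ∈ Finset.range (N + 1), (-2) ^ j * (N.choose j : ℝ) * t ^ (2 * N - j) := by
      intro t
      rw [sub_eq_add_neg, add_comm t, add_pow, Finset.mul_sum]
      refine Finset.sum_congr rfl fun j hj => ?_
      have hj' : j ≤ N := by simpa [Nat.lt_succ_iff] using hj
      rw [show 2 * N - j = N + (N - j) by omega, pow_add]
      ring
    simp_rw [hexp]
    rw [intervalIntegral.integral_finsetSum
      (fun j _ => (Continuous.intervalIntegrable (by fun_prop) _ _)), mul_comm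
      (PowerSeries.exp ℝ), PowerSeries.coeff_mul, Finset.Nat.sum_antidiagonal_eq_sum_range_succ_mk,
      Finset.mul_sum]
    rw [← Finset.sum_subset (Finset.range_subset_range.mpr (show N + 1 ≤ (2 * N + 1).succ by omega))]
    · refine Finset.sum_congr rfl fun j hj => ?_
      have hj' : j ≤ N := by simpa [Nat.lt_succ_iff] using hj
      rw [intervalIntegral.integral_const_mul, integral_pow, Polynomial.coeff_coe,
        coeff_besselPoly, besselCoeff, if_pos hj', PowerSeries.coeff_exp,
        Nat.cast_choose ℝ hj', show 2 * N + 1 - j = (2 * N - j) + 1 by omega, Nat.factorial_succ]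
      have h1 := Nat.factorial_ne_zero j
      have h2 := Nat.factorial_ne_zero (N - j)
      have h3 := Nat.factorial_ne_zero (2 * N - j)
      have h4 := Nat.factorial_ne_zero N
      simp
      field_simp
    · intro j _ hj
      rw [Polynomial.coeff_coe, coeff_besselPoly, besselCoeff, if_neg (by simpa using hj), zero_mul]
  rw [hval]
  refine mul_ne_zero (by positivity) ?_
  have hpos : 0 < ∫ t in (0 : ℝ)..1, t ^ N * (2 - t) ^ N := by
    refine intervalIntegral.intervalIntegral_pos_of_pos_on
      (Continuous.intervalIntegrable (by fun_prop) _ _) (fun t ht => ?_) one_pos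
    have h1 : 0 < t := ht.1
    have h2 : 0 < 2 - t := by linarith [ht.2]
    positivity
  have hsign : (fun t : ℝ => t ^ N * (t - 2) ^ N) =
      fun t => (-1) ^ N * (t ^ N * (2 - t) ^ N) := by
    funext t
    rw [show t - 2 = (-1) * (2 - t) by ring, mul_pow]
    ring
  rw [hsign, intervalIntegral.integral_const_mul]
  exact mul_ne_zero (pow_ne_zero _ (by norm_num)) hpos.ne'

/-- The parity structure of the Taylor coefficients of `w² F(w)`: odd ones below `n` vanish,
all the others are nonzero. -/
structure TaylorParity (n : ℕ) (g : ℕ → ℝ) : Prop where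
  zero : g 0 = 0
  odd_lt : ∀ s, Odd s → s < n → g s = 0
  odd_ge : ∀ s, Odd s → n ≤ s → g s ≠ 0
  even : ∀ s, Even s → 2 ≤ s → g s ≠ 0

theorem taylorParity_besselPoly (N : ℕ) :
    TaylorParity (2 * N + 3) fun s => PowerSeries.coeff s
      (PowerSeries.exp ℝ * ((Polynomial.X ^ 2 * besselPoly N : Polynomial ℝ) : PowerSeries ℝ)) := by
  have hX : (PowerSeries.exp ℝ * ((Polynomial.X ^ 2 * besselPoly N : Polynomial ℝ) :
      PowerSeries ℝ)) = PowerSeries.X ^ 2 * (PowerSeries.exp ℝ * (besselPoly N : PowerSeries ℝ)) := by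
    push_cast
    ring
  have hc := coeff_exp_mul_besselPoly_recurrence N
  have htop := coeff_exp_mul_besselPoly_ne_zero N
  have h0 : PowerSeries.coeff 0 (PowerSeries.exp ℝ * (besselPoly N : PowerSeries ℝ)) ≠ 0 := by
    rw [PowerSeries.coeff_mul]
    simp only [Finset.HasAntidiagonal.antidiagonal_zero, Finset.sum_singleton, PowerSeries.coeff_exp,
      Polynomial.coeff_coe, coeff_besselPoly, besselCoeff]
    simp only [zero_le, if_true]
    simp [Nat.factorial_ne_zero]
  rw [hX]
  generalize PowerSeries.exp ℝ * (besselPoly N : PowerSeries ℝ) = F at *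
  have hodd : ∀ i, i < N → PowerSeries.coeff (2 * i + 1) F = 0 := by
    intro i
    induction i with
    | zero =>
      intro h
      have := (hc 0).2
      exact (mul_eq_zero.mp this).resolve_left (by positivity)
    | succ i ih =>
      intro h
      have h1 := (hc (2 * i + 1)).1
      rw [ih (by omega)] at h1
      refine (mul_eq_zero.mp h1).resolve_left (mul_ne_zero (by positivity) ?_)
      have : ((i + 1 : ℕ) : ℝ) < N := by exact_mod_cast h
      push_cast at this ⊢
      intro h3
      linarith
  have hodd' : ∀ i, PowerSeries.coeff (2 * N + 1 + 2 * i) F ≠ 0 := by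
    intro i
    induction i with
    | zero => exact htop
    | succ i ih =>
      have h1 := (hc (2 * N + 1 + 2 * i)).1
      rw [← h1] at ih
      exact right_ne_zero_of_mul ih
  have heven : ∀ i, PowerSeries.coeff (2 * i) F ≠ 0 := by
    intro i
    induction i with
    | zero => exact h0
    | succ i ih =>
      have h1 := (hc (2 * i)).1
      rw [← h1] at ih
      exact right_ne_zero_of_mul ih
  constructor
  · simp [PowerSeries.coeff_X_pow_mul']
  · rintro s ⟨k, rfl⟩ hs
    rw [PowerSeries.coeff_X_pow_mul']
    split_ifs with h
    · rw [show 2 * k + 1 - 2 = 2 * (k - 1) + 1 by omega]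
      exact hodd _ (by omega)
    · rfl
  · rintro s ⟨k, rfl⟩ hs
    rw [PowerSeries.coeff_X_pow_mul', if_pos (by omega),
      show 2 * k + 1 - 2 = 2 * N + 1 + 2 * (k - N - 1) by omega]
    exact hodd' _
  · rintro s ⟨k, rfl⟩ hs
    rw [PowerSeries.coeff_X_pow_mul', if_pos (by omega), show k + k - 2 = 2 * (k - 1) by omega]
    exact heven _

theorem taylorParity_one :
    TaylorParity 1 fun s => PowerSeries.coeff s
      (PowerSeries.exp ℝ * ((Polynomial.C (-(1 / 2)) * Polynomial.X : Polynomial ℝ) :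
        PowerSeries ℝ)) := by
  have hX : (PowerSeries.exp ℝ * ((Polynomial.C (-(1 / 2)) * Polynomial.X : Polynomial ℝ) :
      PowerSeries ℝ)) = PowerSeries.X * (PowerSeries.C (-(1 / 2)) * PowerSeries.exp ℝ) := by
    push_cast
    ring
  rw [hX]
  have hne : ∀ s : ℕ, 1 ≤ s → PowerSeries.coeff s
      (PowerSeries.X * (PowerSeries.C (-(1 / 2) : ℝ) * PowerSeries.exp ℝ)) ≠ 0 := by
    rintro (_ | s) hs
    · omega
    · rw [PowerSeries.coeff_succ_X_mul, PowerSeries.coeff_C_mul, PowerSeries.coeff_exp]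
      simp [Nat.factorial_ne_zero]
  constructor
  · simp
  · rintro s ⟨k, rfl⟩ hs
    omega
  · exact fun s _ hs => hne s hs
  · exact fun s _ hs => hne s (by omega)

/-- A smooth function on `(0, ∞)` whose `l`-th derivative is `O(z ^ max (θ - l) μ)` for `z ≥ 1`. -/
structure SymbolAtInfinity (θ μ : ℤ) (f : ℝ → ℂ) : Prop where
  contDiffOn : ∀ k : ℕ, ContDiffOn ℝ k f (Set.Ioi 0)
  bound : ∀ l : ℕ, ∃ C : ℝ, 0 < C ∧ ∀ z : ℝ, 1 ≤ z →
    ‖iteratedDerivWithin l f (Set.Ioi 0) z‖ ≤ C * z ^ max (θ - l) μ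

theorem hasDerivAt_ofReal_zpow (q : ℤ) {z : ℝ} (hz : 0 < z) :
    HasDerivAt (fun z : ℝ => (z : ℂ) ^ q) (q * (z : ℂ) ^ (q - 1)) z :=
  (hasDerivAt_zpow q (z : ℂ) (Or.inl (by exact_mod_cast hz.ne'))).comp_ofReal

theorem contDiffOn_ofReal_zpow (q : ℤ) (k : ℕ) :
    ContDiffOn ℝ k (fun z : ℝ => (z : ℂ) ^ q) (Set.Ioi 0) := by
  have h : ∀ j : ℕ, ContDiffOn ℝ k (fun z : ℝ => (z : ℂ) ^ j) (Set.Ioi 0) := fun j =>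
    (Complex.ofRealCLM.contDiff.pow j).contDiffOn
  obtain ⟨j, rfl | rfl⟩ := q.eq_nat_or_neg
  · simpa only [zpow_natCast] using h j
  · simp only [zpow_neg, zpow_natCast]
    exact (h j).inv fun z hz => pow_ne_zero _ (by exact_mod_cast (ne_of_gt hz))

namespace SymbolAtInfinity

variable {θ μ : ℤ} {f g : ℝ → ℂ}

theorem congr (hf : SymbolAtInfinity θ μ f) (h : Set.EqOn g f (Set.Ioi 0)) :
    SymbolAtInfinity θ μ g where
  contDiffOn k := (hf.contDiffOn k).congr h
  bound l := by
    obtain ⟨C, hC, hb⟩ := hf.bound l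
    refine ⟨C, hC, fun z hz => ?_⟩
    rw [iteratedDerivWithin_congr h (show z ∈ Set.Ioi 0 from by
      simp only [Set.mem_Ioi]; linarith)]
    exact hb z hz

theorem zero : SymbolAtInfinity θ μ fun _ => 0 where
  contDiffOn _ := contDiffOn_const
  bound l := ⟨1, one_pos, fun z hz => by
    rw [iteratedDerivWithin_fun_const_zero, norm_zero]
    positivity⟩

theorem add (hf : SymbolAtInfinity θ μ f) (hg : SymbolAtInfinity θ μ g) :
    SymbolAtInfinity θ μ fun z => f z + g z where
  contDiffOn k := (hf.contDiffOn k).add (hg.contDiffOn k)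
  bound l := by
    obtain ⟨C, hC, hb⟩ := hf.bound l
    obtain ⟨D, hD, hd⟩ := hg.bound l
    refine ⟨C + D, add_pos hC hD, fun z hz => ?_⟩
    have hz' : z ∈ Set.Ioi (0 : ℝ) := by
      simp only [Set.mem_Ioi]
      linarith
    rw [iteratedDerivWithin_fun_add hz' (uniqueDiffOn_Ioi 0) (hf.contDiffOn l z hz')
      (hg.contDiffOn l z hz'), add_mul]
    exact (norm_add_le _ _).trans (add_le_add (hb z hz) (hd z hz))

theorem const_mul (c : ℂ) (hf : SymbolAtInfinity θ μ f) :
    SymbolAtInfinity θ μ fun z => c * f z where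
  contDiffOn k := contDiffOn_const.mul (hf.contDiffOn k)
  bound l := by
    obtain ⟨C, hC, hb⟩ := hf.bound l
    refine ⟨(‖c‖ + 1) * C, by positivity, fun z hz => ?_⟩
    have hz' : z ∈ Set.Ioi (0 : ℝ) := by
      simp only [Set.mem_Ioi]
      linarith
    rw [iteratedDerivWithin_const_mul hz' (uniqueDiffOn_Ioi 0) c (hf.contDiffOn l z hz'),
      norm_mul, mul_assoc]
    gcongr
    · linarith
    · exact hb z hz

theorem sum {ι : Type*} (s : Finset ι) {F : ι → ℝ → ℂ}
    (hF : ∀ i ∈ s, SymbolAtInfinity θ μ (F i)) :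
    SymbolAtInfinity θ μ fun z => ∑ i ∈ s, F i z := by
  classical
  induction s using Finset.induction_on with
  | empty => simpa using zero
  | insert i s hi ih =>
    simp only [Finset.sum_insert hi]
    exact (hF i (by simp)).add (ih fun j hj => hF j (by simp [hj]))

theorem zpow {q : ℤ} (hq : q ≤ θ) : SymbolAtInfinity θ μ fun z : ℝ => (z : ℂ) ^ q where
  contDiffOn := contDiffOn_ofReal_zpow q
  bound l := by
    have key : ∀ (l : ℕ) (q : ℤ), ∃ C : ℝ, 0 < C ∧ ∀ z : ℝ, 1 ≤ z →
        ‖iteratedDerivWithin l (fun z : ℝ => (z : ℂ) ^ q) (Set.Ioi 0) z‖ ≤ C * z ^ (q - l) := by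
      intro l
      induction l with
      | zero =>
        refine fun q => ⟨1, one_pos, fun z hz => ?_⟩
        simp [abs_of_pos (one_pos.trans_le hz)]
      | succ l ih =>
        intro q
        obtain ⟨C, hC, hb⟩ := ih (q - 1)
        refine ⟨(‖(q : ℂ)‖ + 1) * C, by positivity, fun z hz => ?_⟩
        have hz' : z ∈ Set.Ioi (0 : ℝ) := by
          simp only [Set.mem_Ioi]
          linarith
        have hd : Set.EqOn (derivWithin (fun z : ℝ => (z : ℂ) ^ q) (Set.Ioi 0))
            (fun z : ℝ => (q : ℂ) * (z : ℂ) ^ (q - 1)) (Set.Ioi 0) := fun y hy =>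
          (hasDerivAt_ofReal_zpow q hy).hasDerivWithinAt.derivWithin (uniqueDiffOn_Ioi 0 y hy)
        rw [iteratedDerivWithin_succ', iteratedDerivWithin_congr hd hz',
          iteratedDerivWithin_const_mul hz' (uniqueDiffOn_Ioi 0) _
            (contDiffOn_ofReal_zpow (q - 1) l z hz'), norm_mul, mul_assoc]
        have := hb z hz
        rw [show q - 1 - (l : ℤ) = q - ((l + 1 : ℕ) : ℤ) by push_cast; ring] at this
        gcongr
        linarith
    obtain ⟨C, hC, hb⟩ := key l q
    refine ⟨C, hC, fun z hz => (hb z hz).trans ?_⟩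
    gcongr ?_ * ?_
    exact zpow_le_zpow_right₀ hz (le_max_of_le_left (by linarith))

theorem zpow_mul_exp {q : ℤ} (hq : q ≤ μ) {a : ℂ} (ha : a.re ≤ 0) :
    SymbolAtInfinity θ μ fun z : ℝ => (z : ℂ) ^ q * Complex.exp (a * z) := by
  have hsm : ∀ (q : ℤ) (k : ℕ), ContDiffOn ℝ k
      (fun z : ℝ => (z : ℂ) ^ q * Complex.exp (a * z)) (Set.Ioi 0) := fun q k =>
    (contDiffOn_ofReal_zpow q k).mul
      (contDiff_const.mul Complex.ofRealCLM.contDiff).cexp.contDiffOn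
  refine ⟨hsm q, fun l => ?_⟩
  have key : ∀ (l : ℕ) (q : ℤ), ∃ C : ℝ, 0 < C ∧ ∀ z : ℝ, 1 ≤ z →
      ‖iteratedDerivWithin l (fun z : ℝ => (z : ℂ) ^ q * Complex.exp (a * z)) (Set.Ioi 0) z‖ ≤
        C * z ^ q := by
    intro l
    induction l with
    | zero =>
      refine fun q => ⟨1, one_pos, fun z hz => ?_⟩
      have hz0 : 0 < z := by linarith
      have he : ‖Complex.exp (a * z)‖ ≤ 1 := by
        rw [Complex.norm_exp, Real.exp_le_one_iff]
        simpa using mul_nonpos_of_nonpos_of_nonneg ha hz0.le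
      rw [iteratedDerivWithin_zero, norm_mul, norm_zpow, Complex.norm_real, Real.norm_eq_abs,
        abs_of_pos hz0, one_mul]
      exact mul_le_of_le_one_right (by positivity) he
    | succ l ih =>
      intro q
      obtain ⟨C, hC, hb⟩ := ih (q - 1)
      obtain ⟨D, hD, hd'⟩ := ih q
      refine ⟨‖(q : ℂ)‖ * C + (‖a‖ + 1) * D, by positivity, fun z hz => ?_⟩
      have hz0 : 0 < z := by linarith
      have hz' : z ∈ Set.Ioi (0 : ℝ) := hz0
      have hd : Set.EqOn
          (derivWithin (fun z : ℝ => (z : ℂ) ^ q * Complex.exp (a * z)) (Set.Ioi 0))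
          (fun z : ℝ => (q : ℂ) * ((z : ℂ) ^ (q - 1) * Complex.exp (a * z)) +
            a * ((z : ℂ) ^ q * Complex.exp (a * z))) (Set.Ioi 0) := by
        intro y hy
        have h1 : HasDerivAt (fun z : ℝ => Complex.exp (a * z)) (Complex.exp (a * y) * a) y := by
          have := ((hasDerivAt_id (y : ℂ)).const_mul a).cexp.comp_ofReal
          simpa using this
        rw [((hasDerivAt_ofReal_zpow q hy).fun_mul h1).hasDerivWithinAt.derivWithin
          (uniqueDiffOn_Ioi 0 y hy)]
        ring
      rw [iteratedDerivWithin_succ', iteratedDerivWithin_congr hd hz',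
        iteratedDerivWithin_fun_add hz' (uniqueDiffOn_Ioi 0)
          ((contDiffOn_const.mul (hsm (q - 1) l)) z hz') ((contDiffOn_const.mul (hsm q l)) z hz'),
        iteratedDerivWithin_const_mul hz' (uniqueDiffOn_Ioi 0) _ (hsm (q - 1) l z hz'),
        iteratedDerivWithin_const_mul hz' (uniqueDiffOn_Ioi 0) _ (hsm q l z hz'), add_mul]
      refine (norm_add_le _ _).trans (add_le_add ?_ ?_)
      · rw [norm_mul, mul_assoc]
        gcongr
        refine (hb z hz).trans ?_
        gcongr ?_ * ?_
        exact zpow_le_zpow_right₀ hz (by linarith)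
      · rw [norm_mul, mul_assoc]
        gcongr
        · linarith
        · exact hd' z hz
  obtain ⟨C, hC, hb⟩ := key l q
  refine ⟨C, hC, fun z hz => (hb z hz).trans ?_⟩
  gcongr ?_ * ?_
  exact zpow_le_zpow_right₀ hz (le_max_of_le_right hq)

end SymbolAtInfinity

theorem exists_iteratedDerivWithin_pow_mul_bound (p l : ℕ) {h : ℝ → ℂ}
    (hh : ContDiff ℝ (⊤ : ℕ∞) h) : ∃ C : ℝ, 0 < C ∧ ∀ z : ℝ, 0 < z → z ≤ 1 →
      ‖iteratedDerivWithin l (fun z : ℝ => (z : ℂ) ^ p * h z) (Set.Ioi 0) z‖ ≤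
        C * z ^ (p - l) := by
  induction l generalizing p h with
  | zero =>
    obtain ⟨C, hC⟩ := (isCompact_Icc (a := (0 : ℝ)) (b := 1)).exists_bound_of_continuousOn
      hh.continuous.continuousOn
    refine ⟨|C| + 1, by positivity, fun z hz hz1 => ?_⟩
    rw [iteratedDerivWithin_zero, norm_mul, norm_pow, Complex.norm_real, Real.norm_eq_abs,
      abs_of_pos hz, mul_comm, Nat.sub_zero]
    gcongr
    linarith [hC z ⟨hz.le, hz1⟩, le_abs_self C]
  | succ l ih =>
    have hh' : ContDiff ℝ (⊤ : ℕ∞) (deriv h) := (contDiff_infty_iff_deriv.mp hh).2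
    have hdh : ∀ y, HasDerivAt h (deriv h y) y := fun y =>
      ((contDiff_infty_iff_deriv.mp hh).1 y).hasDerivAt
    rcases p with _ | p
    · obtain ⟨C, hC, hb⟩ := ih 0 hh'
      refine ⟨C, hC, fun z hz hz1 => ?_⟩
      have hd : Set.EqOn (derivWithin (fun z : ℝ => (z : ℂ) ^ 0 * h z) (Set.Ioi 0))
          (fun z : ℝ => (z : ℂ) ^ 0 * deriv h z) (Set.Ioi 0) := by
        intro y hy
        simp only [pow_zero, one_mul]
        exact (hdh y).hasDerivWithinAt.derivWithin (uniqueDiffOn_Ioi 0 y hy)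
      rw [iteratedDerivWithin_succ', iteratedDerivWithin_congr hd hz]
      simpa using hb z hz hz1
    · have hH : ContDiff ℝ (⊤ : ℕ∞) fun z : ℝ => ((p + 1 : ℕ) : ℂ) * h z + z * deriv h z :=
        (contDiff_const.mul hh).add (Complex.ofRealCLM.contDiff.mul hh')
      obtain ⟨C, hC, hb⟩ := ih p hH
      refine ⟨C, hC, fun z hz hz1 => ?_⟩
      have hd : Set.EqOn (derivWithin (fun z : ℝ => (z : ℂ) ^ (p + 1) * h z) (Set.Ioi 0))
          (fun z : ℝ => (z : ℂ) ^ p * (((p + 1 : ℕ) : ℂ) * h z + z * deriv h z))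
          (Set.Ioi 0) := by
        intro y hy
        have h1 : HasDerivAt (fun z : ℝ => (z : ℂ) ^ (p + 1)) (((p + 1 : ℕ) : ℂ) * (y : ℂ) ^ p) y :=
          (hasDerivAt_pow (p + 1) (y : ℂ)).comp_ofReal
        rw [(h1.fun_mul (hdh y)).hasDerivWithinAt.derivWithin (uniqueDiffOn_Ioi 0 y hy)]
        ring
      rw [iteratedDerivWithin_succ', iteratedDerivWithin_congr hd hz,
        show p + 1 - (l + 1) = p - l by omega]
      exact hb z hz hz1

/-- The index sets `I⁺ = {0, …, m-1}` and `I⁻ = {1, …, m}`. -/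
abbrev signIndex (m : ℕ) (sgn : Bool) : Finset ℕ :=
  if sgn then Finset.range m else Finset.Icc 1 m

theorem lamK_one (m k : ℕ) :
    lamK m 1 k = Complex.exp (2 * Real.pi * Complex.I / ((2 * m : ℕ) : ℂ)) ^ k := by
  rw [lamK, ← Complex.exp_nat_mul]
  rcases eq_or_ne m 0 with rfl | hm
  · simp
  · have : (m : ℂ) ≠ 0 := by exact_mod_cast hm
    simp only [Complex.ofReal_one, one_mul]
    congr 1
    push_cast
    field_simp

theorem lamK_eq (m : ℕ) (lam : ℝ) (k : ℕ) : lamK m lam k = lam * lamK m 1 k := by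
  simp [lamK]

theorem re_I_mul_lamK_one_nonpos {m k : ℕ} (hk : k ≤ m) :
    (Complex.I * lamK m 1 k).re ≤ 0 := by
  have h : lamK m 1 k = Complex.exp (((k * Real.pi / m : ℝ) : ℂ) * Complex.I) := by
    rw [lamK]
    push_cast
    rw [one_mul]
    congr 1
    ring
  rw [h, Complex.I_mul_re, Complex.exp_ofReal_mul_I_im, neg_nonpos]
  apply Real.sin_nonneg_of_nonneg_of_le_pi
  · positivity
  · rw [mul_comm, mul_div_assoc]
    refine mul_le_of_le_one_right Real.pi_pos.le ?_
    exact div_le_one_of_le₀ (by exact_mod_cast hk) (by positivity)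

theorem sum_signIndex_lamK_one_pow (m : ℕ) (sgn : Bool) (s : ℕ) :
    ∑ k ∈ signIndex m sgn, lamK m 1 k ^ s =
      (if sgn then 1 else lamK m 1 1 ^ s) * ∑ k ∈ Finset.range m, (lamK m 1 1 ^ s) ^ k := by
  have h : ∀ k, lamK m 1 k ^ s = (lamK m 1 1 ^ s) ^ k := fun k => by
    rw [lamK_one, lamK_one, pow_one, ← pow_mul, ← pow_mul, mul_comm k]
  rw [Finset.sum_congr rfl fun k _ => h k]
  cases sgn
  · simp only [signIndex, Bool.false_eq_true, if_false]
    rw [show Finset.Icc 1 m = Finset.Ico 1 (m + 1) by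
        ext
        simp only [Finset.mem_Icc, Finset.mem_Ico]
        omega,
      Finset.sum_Ico_eq_sum_range, Finset.mul_sum]
    exact Finset.sum_congr rfl fun k _ => by rw [pow_add, pow_one]
  · simp [signIndex]

theorem isPrimitiveRoot_lamK_one {m : ℕ} (hm : m ≠ 0) : IsPrimitiveRoot (lamK m 1 1) (2 * m) := by
  rw [lamK_one, pow_one]
  exact Complex.isPrimitiveRoot_exp (2 * m) (by omega)

theorem sum_lamK_one_pow_of_dvd {m : ℕ} (hm : m ≠ 0) (sgn : Bool) {s : ℕ} (hs : 2 * m ∣ s) :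
    ∑ k ∈ signIndex m sgn, lamK m 1 k ^ s = m := by
  have h := ((isPrimitiveRoot_lamK_one hm).pow_eq_one_iff_dvd s).mpr hs
  rw [sum_signIndex_lamK_one_pow, h]
  simp

theorem sum_lamK_one_pow_of_even {m : ℕ} (hm : m ≠ 0) (sgn : Bool) {s : ℕ} (hs : Even s)
    (hs' : ¬ 2 * m ∣ s) : ∑ k ∈ signIndex m sgn, lamK m 1 k ^ s = 0 := by
  have hp := isPrimitiveRoot_lamK_one hm
  have h : lamK m 1 1 ^ s ≠ 1 := fun h => hs' ((hp.pow_eq_one_iff_dvd s).mp h)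
  have h1 : (lamK m 1 1 ^ s) ^ m = 1 := by
    rw [← pow_mul, hp.pow_eq_one_iff_dvd]
    obtain ⟨t, rfl⟩ := hs
    exact ⟨t, by ring⟩
  rw [sum_signIndex_lamK_one_pow, geom_sum_eq h, h1]
  simp

theorem re_sum_lamK_one_pow_of_odd {m : ℕ} (hm : m ≠ 0) (sgn : Bool) {s : ℕ} (hs : Odd s) :
    (∑ k ∈ signIndex m sgn, lamK m 1 k ^ s).re ≠ 0 := by
  have hp := isPrimitiveRoot_lamK_one hm
  have hnd : ¬ 2 * m ∣ s := fun h =>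
    (Nat.not_even_iff_odd.mpr hs) (even_iff_two_dvd.mpr ((dvd_mul_right 2 m).trans h))
  have h : lamK m 1 1 ^ s ≠ 1 := fun h => hnd ((hp.pow_eq_one_iff_dvd s).mp h)
  have hneg : lamK m 1 1 ^ m = -1 := by
    have hsq : (lamK m 1 1 ^ m) ^ 2 = 1 := by rw [← pow_mul, mul_comm, hp.pow_eq_one]
    refine (sq_eq_one_iff.mp hsq).resolve_left ?_
    intro h1
    have := Nat.le_of_dvd (by omega) ((hp.pow_eq_one_iff_dvd m).mp h1)
    omega
  have h1 : (lamK m 1 1 ^ s) ^ m = -1 := by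
    rw [← pow_mul, mul_comm, pow_mul, hneg, hs.neg_one_pow]
  have hnorm : ‖lamK m 1 1 ^ s‖ = 1 := by
    rw [norm_pow, hp.norm'_eq_one (by omega), one_pow]
  rw [sum_signIndex_lamK_one_pow, geom_sum_eq h, h1]
  generalize lamK m 1 1 ^ s = ζ at *
  have hc : ζ * (starRingEnd ℂ) ζ = 1 := by
    rw [Complex.mul_conj, Complex.normSq_eq_norm_sq, hnorm]
    simp
  have hc1 : (starRingEnd ℂ) ζ ≠ 1 := fun h' => h (by simpa using congrArg (starRingEnd ℂ) h')
  have e1 : ζ - 1 ≠ 0 := sub_ne_zero.mpr h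
  have e2 : (starRingEnd ℂ) ζ - 1 ≠ 0 := sub_ne_zero.mpr hc1
  intro hre
  have hadd := Complex.add_conj ((if sgn = true then 1 else ζ) * ((-1 - 1) / (ζ - 1)))
  rw [hre] at hadd
  cases sgn
  · simp only [Bool.false_eq_true, if_false, map_mul, map_div₀, map_sub, map_neg, map_one] at hadd
    field_simp at hadd
    norm_num at hadd
    exact mul_ne_zero e1 e2 (by linear_combination hadd - hc)
  · simp only [if_true, map_mul, map_div₀, map_sub, map_neg, map_one] at hadd
    field_simp at hadd
    norm_num at hadd
    exact mul_ne_zero e1 e2 (by linear_combination hc - hadd)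

theorem exists_kernelPolynomial {n : ℕ} (hodd : Odd n) : ∃ Q : Polynomial ℝ,
    2 * Q.natDegree ≤ n + 1 ∧
    TaylorParity n (fun s => PowerSeries.coeff s (PowerSeries.exp ℝ * (Q : PowerSeries ℝ))) ∧
    ∀ w : ℂ, w ≠ 0 → w ^ 2 * ∑ j ∈ Finset.Icc (min 0 (((n : ℤ) - 3) / 2)) (((n : ℤ) - 3) / 2),
      ((cCoef n j : ℝ) : ℂ) * w ^ j = Polynomial.aeval w Q := by
  obtain rfl | ⟨N, rfl⟩ : n = 1 ∨ ∃ N, n = 2 * N + 3 := by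
    obtain ⟨k, rfl⟩ := hodd
    rcases k with _ | k
    · exact Or.inl rfl
    · exact Or.inr ⟨k, by ring⟩
  · refine ⟨Polynomial.C (-(1 / 2)) * Polynomial.X, ?_, taylorParity_one, fun w hw => ?_⟩
    · have := Polynomial.natDegree_C_mul_le (-(1 / 2) : ℝ) Polynomial.X
      rw [Polynomial.natDegree_X] at this
      omega
    · have h1 : (((1 : ℕ) : ℤ) - 3) / 2 = -1 := by norm_num
      rw [h1, show min (0 : ℤ) (-1) = -1 by norm_num, Finset.Icc_self, Finset.sum_singleton]
      simp only [cCoef, if_true, map_mul, Polynomial.aeval_C, Polynomial.aeval_X,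
        Complex.coe_algebraMap, zpow_neg_one]
      push_cast
      field_simp
  · refine ⟨Polynomial.X ^ 2 * besselPoly N, ?_, taylorParity_besselPoly N, fun w _ => ?_⟩
    · have h1 : (besselPoly N).natDegree ≤ N :=
        Polynomial.natDegree_sum_le_of_forall_le _ _ fun j hj =>
          (Polynomial.natDegree_monomial_le _).trans (by simpa [Nat.lt_succ_iff] using hj)
      have h2 := Polynomial.natDegree_mul_le (p := (Polynomial.X ^ 2 : Polynomial ℝ))
        (q := besselPoly N)
      rw [Polynomial.natDegree_X_pow] at h2
      omega
    · have h1 : (((2 * N + 3 : ℕ) : ℤ) - 3) / 2 = N := by omega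
      rw [h1, min_eq_left (by positivity), map_mul, map_pow, Polynomial.aeval_X]
      congr 1
      simp only [besselPoly, map_sum, Polynomial.aeval_monomial, Complex.coe_algebraMap]
      refine Finset.sum_nbij' Int.toNat (fun j : ℕ => (j : ℤ)) ?_ ?_ ?_ ?_ ?_
      · intro j hj
        simp only [Finset.mem_Icc, Finset.mem_range] at hj ⊢
        omega
      · intro j hj
        simp only [Finset.mem_Icc, Finset.mem_range] at hj ⊢
        omega
      · intro j hj
        simp only [Finset.mem_Icc] at hj
        omega
      · intro j _
        simp
      · intro j hj
        simp only [Finset.mem_Icc] at hj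
        lift j to ℕ using hj.1
        have hj' : j ≤ N := by exact_mod_cast hj.2
        simp only [Int.toNat_natCast, zpow_natCast]
        rw [cCoef, h1, if_neg (by omega), besselCoeff, if_pos hj']
        simp only [Int.toNat_natCast]
        rw [show 2 * N + 3 - 3 - j = 2 * N - j by omega,
          show ((N : ℤ) - j).toNat = N - j by omega]

theorem R0Kernel_eq_sum {m n : ℕ} (hm : m ≠ 0) {Q : Polynomial ℝ}
    (hQ : ∀ w : ℂ, w ≠ 0 →
      w ^ 2 * ∑ j ∈ Finset.Icc (min 0 (((n : ℤ) - 3) / 2)) (((n : ℤ) - 3) / 2),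
        ((cCoef n j : ℝ) : ℂ) * w ^ j = Polynomial.aeval w Q)
    (sgn : Bool) {lam r : ℝ} (hlam : 0 < lam) (hr : 0 < r) :
    R0Kernel m n sgn lam r =
      ((-(4 * Real.pi) ^ (-(((n : ℝ) - 1) / 2)) / m : ℝ) : ℂ) *
        (lam : ℂ) ^ ((n : ℤ) - 2 * m) * (((lam * r : ℝ) : ℂ) ^ (-(n : ℤ)) *
          ∑ k ∈ signIndex m sgn, Complex.exp (Complex.I * lamK m 1 k * ((lam * r : ℝ) : ℂ)) *
            Polynomial.aeval (Complex.I * lamK m 1 k * ((lam * r : ℝ) : ℂ)) Q) := by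
  have hlc : (lam : ℂ) ≠ 0 := by exact_mod_cast hlam.ne'
  have hrc : (r : ℂ) ≠ 0 := by exact_mod_cast hr.ne'
  have hmc : (m : ℂ) ≠ 0 := by exact_mod_cast hm
  unfold R0Kernel
  rw [Finset.mul_sum, Finset.mul_sum, Finset.mul_sum]
  refine Finset.sum_congr rfl fun k _ => ?_
  have hw : Complex.I * lamK m lam k * (r : ℂ) =
      Complex.I * lamK m 1 k * ((lam * r : ℝ) : ℂ) := by
    rw [lamK_eq]
    push_cast
    ring
  have hl0 : lamK m lam k ≠ 0 := mul_ne_zero hlc (Complex.exp_ne_zero _)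
  have hw0 : Complex.I * lamK m lam k * (r : ℂ) ≠ 0 :=
    mul_ne_zero (mul_ne_zero Complex.I_ne_zero hl0) hrc
  rw [← hw, ← hQ _ hw0]
  generalize ∑ j ∈ Finset.Icc (min 0 (((n : ℤ) - 3) / 2)) (((n : ℤ) - 3) / 2),
        ((cCoef n j : ℝ) : ℂ) * (Complex.I * lamK m lam k * (r : ℂ)) ^ j = S
  have e1 : (r : ℂ) ^ (-((n : ℤ) - 2)) = r ^ 2 * ((r : ℂ) ^ n)⁻¹ := by
    rw [show -((n : ℤ) - 2) = ((2 : ℕ) : ℤ) + -(n : ℤ) by push_cast; ring, zpow_add₀ hrc,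
      zpow_neg, zpow_natCast, zpow_natCast]
  have e2 : (lam : ℂ) ^ ((n : ℤ) - 2 * m) = lam ^ n * ((lam : ℂ) ^ (2 * m))⁻¹ := by
    rw [show (n : ℤ) - 2 * m = (n : ℤ) + -((2 * m : ℕ) : ℤ) by push_cast; ring, zpow_add₀ hlc,
      zpow_neg, zpow_natCast, zpow_natCast]
  have e3 : ((lam * r : ℝ) : ℂ) ^ (-(n : ℤ)) = ((lam : ℂ) ^ n)⁻¹ * ((r : ℂ) ^ n)⁻¹ := by
    rw [zpow_neg, zpow_natCast]
    push_cast
    rw [mul_pow, mul_inv]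
  rw [e1, e2, e3]
  generalize (4 * Real.pi) ^ (-(((n : ℝ) - 1) / 2)) = A
  push_cast
  field_simp
  rw [Complex.I_sq]
  ring

theorem sum_range_eq_of_parity {m n : ℕ} (hm : m ≠ 0) (hodd : Odd n) (hn : n ≤ 4 * m - 1)
    {f : ℕ → ℂ} (hf : ∀ s, s < 4 * m + 1 → s ≠ 2 * m → s ≠ 4 * m → ¬ (Odd s ∧ n ≤ s) → f s = 0) :
    ∑ s ∈ Finset.range (4 * m + 1), f s =
      f (2 * m) + ∑ j ∈ Finset.range ((4 * m - n) / 2 + 1), f (n + 2 * j) + f (4 * m) := by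
  have himg : ∀ s, s ∈ (Finset.range ((4 * m - n) / 2 + 1)).image (fun j => n + 2 * j) ↔
      Odd s ∧ n ≤ s ∧ s ≤ 4 * m := by
    intro s
    obtain ⟨k, rfl⟩ := hodd
    simp only [Finset.mem_image, Finset.mem_range]
    constructor
    · rintro ⟨j, hj, rfl⟩
      exact ⟨⟨k + j, by ring⟩, by omega, by omega⟩
    · rintro ⟨⟨t, rfl⟩, h1, h2⟩
      exact ⟨t - k, by omega, by omega⟩
  have hodd2 : ∀ t, ¬ Odd (2 * t) := fun t h => by
    obtain ⟨u, hu⟩ := h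
    omega
  have hodd4 : ∀ t, ¬ Odd (4 * t) := fun t h => by
    obtain ⟨u, hu⟩ := h
    omega
  have hsub : insert (2 * m) (insert (4 * m)
      ((Finset.range ((4 * m - n) / 2 + 1)).image fun j => n + 2 * j)) ⊆
        Finset.range (4 * m + 1) := by
    intro s hs
    simp only [Finset.mem_insert, himg] at hs
    simp only [Finset.mem_range]
    omega
  rw [← Finset.sum_subset hsub, Finset.sum_insert, Finset.sum_insert, Finset.sum_image]
  · ring
  · intro a _ b _ hab
    simpa using hab
  · rw [himg]
    exact fun h => hodd4 m h.1
  · rw [Finset.mem_insert, himg]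
    rintro (h | h)
    · omega
    · exact hodd2 m h.1
  · intro s hs hs'
    simp only [Finset.mem_insert, himg, not_or, Finset.mem_range] at hs hs'
    exact hf s hs hs'.1 hs'.2.1 fun h => hs'.2.2 ⟨h.1, h.2, by omega⟩

theorem I_pow_mul_im_ne_zero {s : ℕ} (hs : Odd s) {w : ℂ} (hw : w.re ≠ 0) :
    (Complex.I ^ s * w).im ≠ 0 := by
  obtain ⟨k, rfl⟩ := hs
  rw [pow_succ, pow_mul, Complex.I_sq, show (-1 : ℂ) ^ k = (((-1) ^ k : ℝ) : ℂ) by push_cast; rfl,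
    mul_assoc, Complex.im_ofReal_mul, Complex.I_mul_im]
  exact mul_ne_zero (pow_ne_zero _ (by norm_num)) hw

/-- Expansion of the free resolvent kernel at `θ = 4m - n + 1`, odd `1 ≤ n ≤ 4m-1`:
both constant terms `b₀ |x-y|^{2m-n}` and `b₁ λ^{2m} |x-y|^{4m-n}` appear. -/
theorem free_resolvent_expansion_top
    (m n : ℕ) (hm : 2 ≤ m) (hodd : Odd n) (hn1 : 1 ≤ n) (hn2 : n ≤ 4 * m - 1) :
    ∃ b0 b1 : ℝ, b0 ≠ 0 ∧ b1 ≠ 0 ∧ ∀ sgn : Bool, ∃ (a : ℕ → ℂ) (r : ℝ → ℂ),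
      (∀ j ∈ Finset.range ((4 * m - n) / 2 + 1), (a j).im ≠ 0) ∧
      (∀ k : ℕ, ContDiffOn ℝ k r (Set.Ioi 0)) ∧
      (∀ lam : ℝ, 0 < lam → ∀ x y : EuclideanSpace ℝ (Fin n), x ≠ y →
        R0Kernel m n sgn lam (dist x y) =
          ((b0 : ℝ) : ℂ) * (((dist x y ^ (2 * (m : ℤ) - (n : ℤ))) : ℝ) : ℂ) +
          (∑ j ∈ Finset.range ((4 * m - n) / 2 + 1),
            a j * (((lam ^ ((n : ℤ) - 2 * (m : ℤ) + 2 * (j : ℤ))) : ℝ) : ℂ) *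
              (((dist x y ^ (2 * j)) : ℝ) : ℂ)) +
          ((b1 : ℝ) : ℂ) * (((lam ^ (2 * m)) : ℝ) : ℂ) *
            (((dist x y ^ (4 * m - n)) : ℝ) : ℂ) +
          (((lam ^ ((n : ℤ) - 2 * (m : ℤ))) : ℝ) : ℂ) * r (lam * dist x y)) ∧
      (∀ l : ℕ, ∃ C : ℝ, 0 < C ∧
        (∀ z : ℝ, 0 < z → z ≤ 1 →
          ‖iteratedDerivWithin l r (Set.Ioi 0) z‖ ≤
            C * z ^ max ((4 * (m : ℤ) - (n : ℤ) + 1) - l) 0) ∧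
        (∀ z : ℝ, 1 ≤ z →
          ‖iteratedDerivWithin l r (Set.Ioi 0) z‖ ≤
            C * z ^ max ((4 * (m : ℤ) - (n : ℤ) + 1) - l) (-(((n : ℤ) - 1) / 2)))) := by
  have hm0 : m ≠ 0 := by omega
  obtain ⟨Q, hdeg, hpar, hQ⟩ := exists_kernelPolynomial hodd
  obtain ⟨H, hH, hHe⟩ := HasEntireTaylorSeries.exp_mul_polynomial Q (4 * m + 1)
  set g : ℕ → ℝ := fun s => PowerSeries.coeff s (PowerSeries.exp ℝ * (Q : PowerSeries ℝ)) with hg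
  set κ : ℝ := -(4 * Real.pi) ^ (-(((n : ℝ) - 1) / 2)) / m with hκ
  have hκ0 : κ ≠ 0 := div_ne_zero (neg_ne_zero.mpr (by positivity)) (by exact_mod_cast hm0)
  have hmR : (m : ℝ) ≠ 0 := by exact_mod_cast hm0
  refine ⟨κ * (g (2 * m) * ((-1) ^ m * m)), κ * (g (4 * m) * m), ?_, ?_, fun sgn => ?_⟩
  · exact mul_ne_zero hκ0 (mul_ne_zero (hpar.even _ (even_two_mul m) (by omega))
      (mul_ne_zero (pow_ne_zero _ (by norm_num)) hmR))
  · exact mul_ne_zero hκ0 (mul_ne_zero (hpar.even _ ⟨2 * m, by ring⟩ (by omega)) hmR)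
  set T : ℕ → ℂ := fun s =>
    (g s : ℂ) * (Complex.I ^ s * ∑ k ∈ signIndex m sgn, lamK m 1 k ^ s) with hT
  set h : ℝ → ℂ := fun z => (κ : ℂ) * ∑ k ∈ signIndex m sgn,
    (Complex.I * lamK m 1 k) ^ (4 * m + 1) * H (Complex.I * lamK m 1 k * z) with hh
  set p : ℕ := 4 * m + 1 - n with hp
  have hhsm : ContDiff ℝ (⊤ : ℕ∞) h := by
    have hHR : ContDiff ℝ (⊤ : ℕ∞) H := (hH.contDiff (n := (⊤ : ℕ∞))).restrict_scalars ℝ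
    refine contDiff_const.mul (ContDiff.sum fun k _ => contDiff_const.mul (hHR.comp ?_))
    exact contDiff_const.mul Complex.ofRealCLM.contDiff
  have hsum : ∀ z : ℝ, ∑ k ∈ signIndex m sgn, Complex.exp (Complex.I * lamK m 1 k * z) *
      Polynomial.aeval (Complex.I * lamK m 1 k * z) Q =
        ∑ s ∈ Finset.range (4 * m + 1), T s * (z : ℂ) ^ s +
          (z : ℂ) ^ (4 * m + 1) * ∑ k ∈ signIndex m sgn,
            (Complex.I * lamK m 1 k) ^ (4 * m + 1) * H (Complex.I * lamK m 1 k * z) := by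
    intro z
    rw [Finset.sum_congr rfl fun k _ => hHe (Complex.I * lamK m 1 k * z),
      Finset.sum_add_distrib, Finset.sum_comm, Finset.mul_sum]
    congr 1
    · refine Finset.sum_congr rfl fun s _ => ?_
      rw [hT]
      simp only [Finset.mul_sum, Finset.sum_mul]
      exact Finset.sum_congr rfl fun k _ => by
        rw [mul_pow, mul_pow]
        ring
    · exact Finset.sum_congr rfl fun k _ => by
        rw [mul_pow]
        ring
  have hzp : ∀ z : ℝ, 0 < z → (z : ℂ) ^ (-(n : ℤ)) * (z : ℂ) ^ (4 * m + 1) = (z : ℂ) ^ p := by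
    intro z hz
    have hzc : (z : ℂ) ≠ 0 := by exact_mod_cast hz.ne'
    rw [← zpow_natCast, ← zpow_natCast, ← zpow_add₀ hzc]
    congr 1
    omega
  have hr : ∀ z : ℝ, 0 < z → (z : ℂ) ^ p * h z = κ * ((z : ℂ) ^ (-(n : ℤ)) *
      (∑ k ∈ signIndex m sgn, Complex.exp (Complex.I * lamK m 1 k * z) *
        Polynomial.aeval (Complex.I * lamK m 1 k * z) Q -
          ∑ s ∈ Finset.range (4 * m + 1), T s * (z : ℂ) ^ s)) := by
    intro z hz
    rw [hsum z, ← hzp z hz, hh]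
    ring
  have hsym : SymbolAtInfinity (4 * (m : ℤ) - n + 1) (-(((n : ℤ) - 1) / 2))
      (fun z : ℝ => (z : ℂ) ^ p * h z) := by
    have h1 : SymbolAtInfinity (4 * (m : ℤ) - n + 1) (-(((n : ℤ) - 1) / 2)) fun z : ℝ =>
        (∑ k ∈ signIndex m sgn, ∑ i ∈ Finset.range (Q.natDegree + 1),
          (κ * Q.coeff i * (Complex.I * lamK m 1 k) ^ i) *
            ((z : ℂ) ^ ((i : ℤ) - n) * Complex.exp (Complex.I * lamK m 1 k * z))) +
        ∑ s ∈ Finset.range (4 * m + 1), (-(κ * T s)) * (z : ℂ) ^ ((s : ℤ) - n) := by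
      refine (SymbolAtInfinity.sum _ fun k hk => SymbolAtInfinity.sum _ fun i hi =>
        (SymbolAtInfinity.zpow_mul_exp ?_ ?_).const_mul _).add
          (SymbolAtInfinity.sum _ fun s hs => (SymbolAtInfinity.zpow ?_).const_mul _)
      · obtain ⟨t, rfl⟩ := hodd
        rw [Finset.mem_range] at hi
        omega
      · refine re_I_mul_lamK_one_nonpos ?_
        cases sgn
        · exact (Finset.mem_Icc.mp (by simpa [signIndex] using hk)).2
        · exact (Finset.mem_range.mp (by simpa [signIndex] using hk)).le
      · rw [Finset.mem_range] at hs
        omega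
    refine h1.congr fun z hz => ?_
    have hzc : (z : ℂ) ≠ 0 := by exact_mod_cast (ne_of_gt hz)
    have hzq : ∀ i : ℕ, (z : ℂ) ^ ((i : ℤ) - n) = (z : ℂ) ^ (-(n : ℤ)) * (z : ℂ) ^ i := fun i => by
      rw [← zpow_natCast (z : ℂ) i, ← zpow_add₀ hzc]
      congr 1
      ring
    beta_reduce
    rw [hr z hz, mul_sub, mul_sub, sub_eq_add_neg]
    congr 1
    · rw [Finset.mul_sum, Finset.mul_sum]
      refine Finset.sum_congr rfl fun k _ => ?_
      rw [Polynomial.aeval_eq_sum_range, Finset.mul_sum, Finset.mul_sum, Finset.mul_sum]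
      refine Finset.sum_congr rfl fun i _ => ?_
      rw [hzq, mul_pow _ (z : ℂ), Complex.real_smul]
      ring
    · rw [Finset.mul_sum, Finset.mul_sum, ← Finset.sum_neg_distrib]
      refine Finset.sum_congr rfl fun s _ => ?_
      rw [hzq]
      ring
  have hTzero : ∀ s, s < 4 * m + 1 → s ≠ 2 * m → s ≠ 4 * m → ¬ (Odd s ∧ n ≤ s) → T s = 0 := by
    intro s hs hs2 hs4 hso
    rw [hT]
    rcases Nat.even_or_odd s with he | ho
    · rcases Nat.eq_zero_or_pos s with rfl | hs0
      · simp only [hpar.zero, Complex.ofReal_zero, zero_mul]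
      · have hnd : ¬ 2 * m ∣ s := by
          rintro ⟨t, rfl⟩
          have ht2 : t < 3 := by
            by_contra! h3
            have := Nat.mul_le_mul_left (2 * m) h3
            omega
          interval_cases t <;> omega
        simp only [sum_lamK_one_pow_of_even hm0 sgn he hnd, mul_zero]
    · have hlt : s < n := by
        by_contra! h3
        exact hso ⟨ho, h3⟩
      simp only [hpar.odd_lt s ho hlt, Complex.ofReal_zero, zero_mul]
  refine ⟨fun j => κ * T (n + 2 * j), fun z => (z : ℂ) ^ p * h z, ?_, hsym.contDiffOn, ?_,
    fun l => ?_⟩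
  · intro j _
    have ho : Odd (n + 2 * j) := hodd.add_even (even_two_mul j)
    rw [hT]
    simp only
    rw [Complex.im_ofReal_mul, Complex.im_ofReal_mul]
    exact mul_ne_zero hκ0 (mul_ne_zero (hpar.odd_ge _ ho (by omega))
      (I_pow_mul_im_ne_zero ho (re_sum_lamK_one_pow_of_odd hm0 sgn ho)))
  · intro lam hlam x y hxy
    have hd : 0 < dist x y := dist_pos.mpr hxy
    generalize dist x y = d at hd
    have hlc : (lam : ℂ) ≠ 0 := by exact_mod_cast hlam.ne'
    have hdc : (d : ℂ) ≠ 0 := by exact_mod_cast hd.ne'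
    have hz : 0 < lam * d := mul_pos hlam hd
    have hT2 : T (2 * m) = ((g (2 * m) * ((-1) ^ m * m) : ℝ) : ℂ) := by
      rw [hT]
      beta_reduce
      rw [sum_lamK_one_pow_of_dvd hm0 sgn (dvd_refl (2 * m)), pow_mul, Complex.I_sq]
      push_cast
      ring
    have hT4 : T (4 * m) = ((g (4 * m) * m : ℝ) : ℂ) := by
      rw [hT]
      beta_reduce
      rw [sum_lamK_one_pow_of_dvd hm0 sgn (s := 4 * m) ⟨2, by ring⟩, pow_mul,
        Complex.I_pow_four, one_pow, one_mul]
      push_cast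
      ring
    have hscale : ∀ s : ℕ, (lam : ℂ) ^ ((n : ℤ) - 2 * m) *
        (((lam * d : ℝ) : ℂ) ^ (-(n : ℤ)) * ((lam * d : ℝ) : ℂ) ^ s) =
          (lam : ℂ) ^ ((s : ℤ) - 2 * m) * (d : ℂ) ^ ((s : ℤ) - n) := by
      intro s
      push_cast
      rw [← zpow_natCast _ s, mul_zpow, mul_zpow,
        show (s : ℤ) - 2 * m = ((n : ℤ) - 2 * m) + (-(n : ℤ)) + s by ring,
        show (s : ℤ) - n = -(n : ℤ) + s by ring, zpow_add₀ hlc, zpow_add₀ hlc, zpow_add₀ hdc]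
      ring
    rw [R0Kernel_eq_sum hm0 hQ sgn hlam hd, ← hκ]
    have hG := hr (lam * d) hz
    beta_reduce
    rw [hG]
    have hsplit := sum_range_eq_of_parity hm0 hodd hn2
      (f := fun s => T s * ((lam * d : ℝ) : ℂ) ^ s) fun s h1 h2 h3 h4 => by
        rw [hTzero s h1 h2 h3 h4, zero_mul]
    beta_reduce at hsplit
    have hterm2 : ((κ * (g (2 * m) * ((-1) ^ m * m)) : ℝ) : ℂ) *
        ((d ^ (2 * (m : ℤ) - (n : ℤ)) : ℝ) : ℂ) =
          κ * (lam : ℂ) ^ ((n : ℤ) - 2 * m) * (((lam * d : ℝ) : ℂ) ^ (-(n : ℤ)) *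
            (T (2 * m) * ((lam * d : ℝ) : ℂ) ^ (2 * m))) := by
      have := hscale (2 * m)
      rw [show (((2 * m : ℕ) : ℤ) - 2 * m) = 0 by push_cast; ring, zpow_zero, one_mul,
        show (((2 * m : ℕ) : ℤ) - n) = 2 * (m : ℤ) - n by push_cast; ring] at this
      rw [hT2, Complex.ofReal_zpow, ← this, Complex.ofReal_mul]
      ring
    have hterm4 : ((κ * (g (4 * m) * m) : ℝ) : ℂ) * ((lam ^ (2 * m) : ℝ) : ℂ) *
        ((d ^ (4 * m - n) : ℝ) : ℂ) =
          κ * (lam : ℂ) ^ ((n : ℤ) - 2 * m) * (((lam * d : ℝ) : ℂ) ^ (-(n : ℤ)) *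
            (T (4 * m) * ((lam * d : ℝ) : ℂ) ^ (4 * m))) := by
      have := hscale (4 * m)
      rw [show (((4 * m : ℕ) : ℤ) - 2 * m) = ((2 * m : ℕ) : ℤ) by push_cast; ring, zpow_natCast,
        show (((4 * m : ℕ) : ℤ) - n) = ((4 * m - n : ℕ) : ℤ) by omega, zpow_natCast] at this
      rw [hT4, Complex.ofReal_pow, Complex.ofReal_pow, mul_assoc, ← this, Complex.ofReal_mul]
      ring
    have htermj : ∑ j ∈ Finset.range ((4 * m - n) / 2 + 1), (κ * T (n + 2 * j)) *
        ((lam ^ ((n : ℤ) - 2 * (m : ℤ) + 2 * (j : ℤ)) : ℝ) : ℂ) * ((d ^ (2 * j) : ℝ) : ℂ) =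
          κ * (lam : ℂ) ^ ((n : ℤ) - 2 * m) * (((lam * d : ℝ) : ℂ) ^ (-(n : ℤ)) *
            ∑ j ∈ Finset.range ((4 * m - n) / 2 + 1),
              T (n + 2 * j) * ((lam * d : ℝ) : ℂ) ^ (n + 2 * j)) := by
      rw [Finset.mul_sum, Finset.mul_sum]
      refine Finset.sum_congr rfl fun j _ => ?_
      have := hscale (n + 2 * j)
      rw [show (((n + 2 * j : ℕ) : ℤ) - 2 * m) = (n : ℤ) - 2 * m + 2 * j by push_cast; ring,
        show (((n + 2 * j : ℕ) : ℤ) - n) = ((2 * j : ℕ) : ℤ) by push_cast; ring,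
        zpow_natCast] at this
      rw [Complex.ofReal_zpow, Complex.ofReal_pow, mul_assoc, ← this]
      ring
    rw [hterm2, hterm4, htermj, hsplit, Complex.ofReal_zpow]
    ring
  · obtain ⟨C, hC, hb⟩ := exists_iteratedDerivWithin_pow_mul_bound p l hhsm
    obtain ⟨D, hD, hd⟩ := hsym.bound l
    refine ⟨C + D, add_pos hC hD, fun z hz hz1 => ?_, fun z hz => ?_⟩
    · rw [show max (4 * (m : ℤ) - n + 1 - l) 0 = ((p - l : ℕ) : ℤ) by omega, zpow_natCast]
      refine (hb z hz hz1).trans ?_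
      gcongr
      linarith
    · refine (hd z hz).trans ?_
      gcongr
      linarith
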